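/- arXiv:1809.00497 — 2 statements merged into one kernel-verified Lean document; each statement's English description precedes it below -/
import Mathlib

section
/- For the filiform Lie superalgebra F_{1,2}^3 over an algebraically closed field of characteristic zero, the Betti numbers of cohomology with trivial coefficients are dim H^0 = 1 and dim H^k = 2 for all k ≥ 1. -/
open scoped Classical
open Finset

noncomputable section

namespace SuperCE

variable (F : Type*) [Field F] {B : Type*} [Fintype B] [DecidableEq B]

/-- Cochains of the super Chevalley–Eilenberg complex with trivial coefficients:
finitely supported families of coefficients indexed by exponent vectors of monomials in
the dual generators (exterior in duals of even basis vectors, polynomial in duals of odd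
basis vectors). -/
abbrev Cochain (F : Type*) [Field F] (B : Type*) := (B → ℕ) →₀ F

variable (p ord : B → ℕ) (c : B → B → B → F)

/-- exponent vector of a single dual generator -/
def eps (b : B) : B → ℕ := fun x => if x = b then 1 else 0

/-- cohomological (`ℤ`-) degree of a monomial -/
def deg (μ : B → ℕ) : ℕ := ∑ b, μ b

/-- admissible exponent vectors: duals of even basis vectors are exterior generators -/
def IsAdm (μ : B → ℕ) : Prop := ∀ b, p b = 0 → μ b ≤ 1

/-- Koszul sign for multiplying the ordered monomial with exponent vector `μ` by the one
with exponent vector `ν`: two dual generators supercommute, i.e. anticommute except that a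
pair of generators dual to odd basis vectors commutes. -/
def sgnProd (μ ν : B → ℕ) : F :=
  (-1 : F) ^ (∑ b1, ∑ b2, if ord b2 < ord b1 then μ b1 * ν b2 * (1 + p b1 * p b2) else 0)

/-- the supercommutative product of cochains (wedge/polynomial multiplication) -/
def Pmul (f g : Cochain F B) : Cochain F B :=
  f.sum fun μ a => g.sum fun ν b' =>
    if IsAdm p (fun x => μ x + ν x) then
      Finsupp.single (fun x => μ x + ν x) (a * b' * sgnProd F p ord μ ν)
    else 0

/-- coefficients of the differential on a dual generator `x_b*`, namely
`d(x_b*) = ∑_{k<l} (-1)^{|x_k||x_l|} c k l b x_k* x_l* - (1/2) ∑_{k odd} c k k b x_k*²`,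
where `c k l b` is the structure constant of the Lie superalgebra. -/
def dcoef (b k l : B) : F :=
  if ord k < ord l then (-1 : F) ^ (p k * p l) * c k l b
  else if k = l ∧ p k = 1 then -((2 : F)⁻¹) * c k k b
  else 0

/-- target exponent vector obtained from `μ` by differentiating the generator `b`
into the pair `(k, l)` -/
def tgt (μ : B → ℕ) (b k l : B) : B → ℕ :=
  fun x => μ x - eps b x + eps k x + eps l x

/-- the Chevalley–Eilenberg differential of a single monomial, obtained by extending `d`
on generators as a `ℤ`-degree `+1`, parity-even superderivation (Koszul signs included) -/
def dMono (μ : B → ℕ) : Cochain F B :=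
  ∑ b, ∑ k, ∑ l,
    if μ b ≠ 0 ∧ IsAdm p (tgt μ b k l) then
      Finsupp.single (tgt μ b k l)
        (((-1 : F) ^ (∑ b', if ord b' < ord b then μ b' else 0)) *
         (μ b : F) * ((-1 : F) ^ ((μ b - 1) * p b)) *
         ((-1 : F) ^ (p b * ∑ b'', if ord b < ord b'' then μ b'' * p b'' else 0)) *
         dcoef F p ord c b k l *
         sgnProd F p ord (fun x => μ x - eps b x) (fun x => eps k x + eps l x))
    else 0

/-- the Chevalley–Eilenberg differential with trivial coefficients -/
def d : Cochain F B →ₗ[F] Cochain F B :=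
  Finsupp.lsum F fun μ => LinearMap.toSpanSingleton F (Cochain F B) (dMono F p ord c μ)

/-- cochains supported on admissible monomials of cohomological degree `k`,
i.e. the `k`-th term `Λᵏ g*` of the super Chevalley–Eilenberg complex -/
def AdmDeg (k : ℕ) : Submodule F (Cochain F B) where
  carrier := {f | ∀ μ, f μ ≠ 0 → IsAdm p μ ∧ deg μ = k}
  add_mem' := by
    intro f g hf hg μ hμ
    by_cases h1 : f μ = 0
    · exact hg μ (by simpa [Finsupp.add_apply, h1] using hμ)
    · exact hf μ h1
  zero_mem' := by intro μ hμ; simp at hμ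
  smul_mem' := by
    intro a f hf μ hμ
    exact hf μ (fun h0 => hμ (by simp [Finsupp.smul_apply, h0]))

/-- cochains supported on admissible monomials (of any degree), i.e. `Λ• g*` -/
def AdmAll : Submodule F (Cochain F B) where
  carrier := {f | ∀ μ, f μ ≠ 0 → IsAdm p μ}
  add_mem' := by
    intro f g hf hg μ hμ
    by_cases h1 : f μ = 0
    · exact hg μ (by simpa [Finsupp.add_apply, h1] using hμ)
    · exact hf μ h1
  zero_mem' := by intro μ hμ; simp at hμ
  smul_mem' := by
    intro a f hf μ hμ
    exact hf μ (fun h0 => hμ (by simp [Finsupp.smul_apply, h0]))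

/-- degree-`k` cocycles -/
def Zk (k : ℕ) : Submodule F (Cochain F B) :=
  AdmDeg F p k ⊓ LinearMap.ker (d F p ord c)

/-- degree-`k` coboundaries -/
def Bk (k : ℕ) : Submodule F (Cochain F B) :=
  Submodule.map (d F p ord c) (AdmDeg F p (k - 1))

/-- the dimension (Betti number) of the `k`-th Lie superalgebra cohomology
`H^k = Z^k / B^k` with trivial coefficients -/
def Hdim (k : ℕ) : ℕ :=
  Module.finrank F ↥(Zk F p ord c k) -
    Module.finrank F ↥(Bk F p ord c k ⊓ Zk F p ord c k)

end SuperCE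

end

noncomputable section
namespace Paper
open SuperCE

/-- parity of the basis (evens then odds) -/
def pF123 : Fin 2 ⊕ Fin 2 → ℕ := Sum.elim (fun _ => 0) (fun _ => 1)

/-- ordering of the basis -/
def ordF123 : Fin 2 ⊕ Fin 2 → ℕ :=
  Sum.elim (fun i => (i : ℕ)) (fun j => 2 + (j : ℕ))

/-- structure constants -/
def cF123 (F : Type*) [Field F] :
    (Fin 2 ⊕ Fin 2) → (Fin 2 ⊕ Fin 2) → (Fin 2 ⊕ Fin 2) → F :=
  fun a b t =>
    if a = Sum.inl (0 : Fin 2) ∧ b = Sum.inr (0 : Fin 2) ∧ t = Sum.inr (1 : Fin 2) then 1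
    else if a = Sum.inr (0 : Fin 2) ∧ b = Sum.inl (0 : Fin 2) ∧ t = Sum.inr (1 : Fin 2) then -1
    else    if a = Sum.inr (0 : Fin 2) ∧ b = Sum.inr (0 : Fin 2) ∧ t = Sum.inl (1 : Fin 2) then 1
    else 0

end Paper
end

noncomputable section
namespace Paper
open SuperCE

/-- The exponent vector of the monomial `X₀*^i X₁*^j Y₁*^m Y₂*^n`. -/
def expVec (i j m n : ℕ) : Fin 2 ⊕ Fin 2 → ℕ := Sum.elim ![i, j] ![m, n]

lemma expVec_inj {i j m n i' j' m' n' : ℕ} :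
    expVec i j m n = expVec i' j' m' n' ↔ i = i' ∧ j = j' ∧ m = m' ∧ n = n' := by
  refine ⟨fun h => ⟨?_, ?_, ?_, ?_⟩, by rintro ⟨rfl, rfl, rfl, rfl⟩; rfl⟩
  · exact congrFun h (Sum.inl 0)
  · exact congrFun h (Sum.inl 1)
  · exact congrFun h (Sum.inr 0)
  · exact congrFun h (Sum.inr 1)

lemma eq_expVec (μ : Fin 2 ⊕ Fin 2 → ℕ) :
    μ = expVec (μ (Sum.inl 0)) (μ (Sum.inl 1)) (μ (Sum.inr 0)) (μ (Sum.inr 1)) := by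
  ext (x | x) <;> fin_cases x <;> rfl

lemma isAdm_expVec {i j m n : ℕ} : IsAdm pF123 (expVec i j m n) ↔ i ≤ 1 ∧ j ≤ 1 := by
  simp [IsAdm, expVec, pF123]

lemma deg_expVec (i j m n : ℕ) : deg (expVec i j m n) = i + j + m + n := by
  simp [deg, expVec, add_assoc]

lemma tgt_Y₂ (i j m n : ℕ) :
    tgt (expVec i j m n) (Sum.inr 1) (Sum.inl 0) (Sum.inr 0) =
      expVec (i + 1) j (m + 1) (n - 1) := by
  ext (x | x) <;> fin_cases x <;> simp [tgt, eps, expVec]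

lemma tgt_X₁ (i j m n : ℕ) :
    tgt (expVec i j m n) (Sum.inl 1) (Sum.inr 0) (Sum.inr 0) =
      expVec i (j - 1) (m + 2) n := by
  ext (x | x) <;> fin_cases x <;> simp [tgt, eps, expVec]

section

variable (F : Type*) [Field F]

/-- The monomial cochain `X₀*^i X₁*^j Y₁*^m Y₂*^n`. -/
def mono (i j m n : ℕ) : Cochain F (Fin 2 ⊕ Fin 2) := Finsupp.single (expVec i j m n) 1

/-- The differential of the cochain complex of `F_{1,2}³`. -/
abbrev dF123 : Cochain F (Fin 2 ⊕ Fin 2) →ₗ[F] Cochain F (Fin 2 ⊕ Fin 2) :=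
  d F pF123 ordF123 (cF123 F)

lemma sgnProd_Y₁_sq (i j m n : ℕ) :
    sgnProd F pF123 ordF123 (expVec i j m n) (expVec 0 0 2 0) = 1 := by
  simp only [sgnProd]
  apply Even.neg_one_pow
  simp [ordF123, pF123, expVec]

lemma sgnProd_X₀_Y₁ (i j m n : ℕ) :
    sgnProd F pF123 ordF123 (expVec i j m n) (expVec 1 0 1 0) = (-1) ^ (j + m + n) := by
  simp only [sgnProd]
  apply neg_one_pow_congr
  simp [ordF123, pF123, expVec]
  grind

lemma dMono_expVec (i j m n : ℕ) (hj : j ≤ 1) :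
    dMono F pF123 ordF123 (cF123 F) (expVec i j m n) =
      (if n ≠ 0 ∧ i = 0 then
        Finsupp.single (expVec (i + 1) j (m + 1) (n - 1)) (n : F) else 0) +
      (if j ≠ 0 ∧ i ≤ 1 then
        Finsupp.single (expVec i (j - 1) (m + 2) n) (-(2⁻¹) * (-1) ^ i * (j : F)) else 0) := by
  have hX : (fun x => expVec i j m n x - eps (Sum.inl 1) x) = expVec i (j - 1) m n := by
    ext (x | x) <;> fin_cases x <;> simp [eps, expVec]
  have hY : (fun x => expVec i j m n x - eps (Sum.inr 1) x) = expVec i j m (n - 1) := by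
    ext (x | x) <;> fin_cases x <;> simp [eps, expVec]
  have hYY : (fun x => eps (Sum.inr (0 : Fin 2)) x + eps (Sum.inr (0 : Fin 2)) x) =
      expVec 0 0 2 0 := by
    ext (x | x) <;> fin_cases x <;> simp [eps, expVec]
  have hXY : (fun x => eps (Sum.inl (0 : Fin 2)) x + eps (Sum.inr (0 : Fin 2)) x) =
      expVec 1 0 1 0 := by
    ext (x | x) <;> fin_cases x <;> simp [eps, expVec]
  simp only [dMono, Fintype.sum_sum_type, Fin.sum_univ_two, hX, hY, hYY, hXY, tgt_X₁, tgt_Y₂,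
    isAdm_expVec, sgnProd_Y₁_sq, sgnProd_X₀_Y₁]
  rw [add_comm (ite _ _ _)]
  simp [dcoef, ordF123, cF123, pF123, -Finsupp.single_mul]
  have hexp : ((-1 : F) ^ (j + m) * n * (-1) ^ (n - 1) * (-1) ^ (j + m + (n - 1))) = n := by
    have h : (-1 : F) ^ (j + m + (n - 1) + (j + m + (n - 1))) = 1 := Even.neg_one_pow ⟨_, rfl⟩
    simp only [pow_add] at h ⊢
    linear_combination (n : F) * h
  have e₀ : expVec i j m n (Sum.inl 0) = i := rfl
  have e₁ : expVec i j m n (Sum.inl 1) = j := rfl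
  have e₂ : expVec i j m n (Sum.inr 0) = m := rfl
  have e₃ : expVec i j m n (Sum.inr 1) = n := rfl
  have hj' : j ≤ 2 := by omega
  rw [add_comm]
  simp only [e₀, e₁, e₂, e₃, hj, hj', and_true]
  congr 1
  · split_ifs with h
    · obtain ⟨-, rfl⟩ := h
      rw [zero_add, zero_add, hexp]
    · rfl
  · congr 3
    ring

lemma dF123_mono (i j m n : ℕ) : dF123 F (mono F i j m n) =
    dMono F pF123 ordF123 (cF123 F) (expVec i j m n) := by
  simp [dF123, d, mono]

lemma single_expVec (i j m n : ℕ) (r : F) :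
    (Finsupp.single (expVec i j m n) r : Cochain F (Fin 2 ⊕ Fin 2)) = r • mono F i j m n := by
  simp [mono]

lemma d_YY (m n : ℕ) :
    dF123 F (mono F 0 0 m n) = (n : F) • mono F 1 0 (m + 1) (n - 1) := by
  rw [dF123_mono, dMono_expVec F _ _ _ _ zero_le_one]
  by_cases hn : n = 0 <;> simp [hn, single_expVec]

lemma d_X₀YY (m n : ℕ) : dF123 F (mono F 1 0 m n) = 0 := by
  rw [dF123_mono, dMono_expVec F _ _ _ _ zero_le_one]
  simp

lemma d_X₁YY (m n : ℕ) : dF123 F (mono F 0 1 m n) =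
    -(2⁻¹ : F) • mono F 0 0 (m + 2) n + (n : F) • mono F 1 1 (m + 1) (n - 1) := by
  rw [dF123_mono, dMono_expVec F _ _ _ _ le_rfl, add_comm]
  by_cases hn : n = 0 <;> simp [hn, single_expVec]

lemma d_X₀X₁YY (m n : ℕ) :
    dF123 F (mono F 1 1 m n) = (2⁻¹ : F) • mono F 1 0 (m + 2) n := by
  rw [dF123_mono, dMono_expVec F _ _ _ _ le_rfl]
  simp [single_expVec]

lemma mono_mem_admDeg {i j m n k : ℕ} (hi : i ≤ 1) (hj : j ≤ 1) (h : i + j + m + n = k) :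
    mono F i j m n ∈ AdmDeg F pF123 k := by
  intro μ hμ
  obtain rfl : μ = expVec i j m n := by
    by_contra hne
    exact hμ (Finsupp.single_eq_of_ne hne)
  exact ⟨isAdm_expVec.2 ⟨hi, hj⟩, by rw [deg_expVec, h]⟩

lemma admDeg_eq_supported (k : ℕ) : AdmDeg F pF123 k =
    Finsupp.supported F F {μ : Fin 2 ⊕ Fin 2 → ℕ | IsAdm pF123 μ ∧ deg μ = k} := by
  ext f
  rw [Finsupp.mem_supported]
  exact ⟨fun h μ hμ => h μ (Finsupp.mem_support_iff.1 hμ),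
    fun h μ hμ => h (Finsupp.mem_support_iff.2 hμ)⟩

lemma admDeg_le_iff (k : ℕ) (S : Submodule F (Cochain F (Fin 2 ⊕ Fin 2))) :
    AdmDeg F pF123 k ≤ S ↔
      ∀ i j m n, i ≤ 1 → j ≤ 1 → i + j + m + n = k → mono F i j m n ∈ S := by
  refine ⟨fun h i j m n hi hj hk => h (mono_mem_admDeg F hi hj hk), fun h => ?_⟩
  rw [admDeg_eq_supported, Finsupp.supported_eq_span_single, Submodule.span_le]
  rintro _ ⟨μ, ⟨hμ, hk⟩, rfl⟩
  rw [eq_expVec μ, isAdm_expVec] at hμ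
  rw [eq_expVec μ, deg_expVec] at hk
  have := h _ _ _ _ hμ.1 hμ.2 hk
  rwa [mono, ← eq_expVec μ] at this

/-- The exponent vectors of the admissible monomials of degree `k + 1`. -/
def admVec (k : ℕ) : Fin (k + 2) ⊕ Fin (k + 1) ⊕ Fin (k + 1) ⊕ Fin k → Fin 2 ⊕ Fin 2 → ℕ :=
  Sum.elim (fun n => expVec 0 0 (k + 1 - n) n) <| Sum.elim (fun n => expVec 1 0 (k - n) n) <|
    Sum.elim (fun n => expVec 0 1 (k - n) n) (fun n => expVec 1 1 (k - 1 - n) n)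

lemma admVec_injective (k : ℕ) : Function.Injective (admVec k) := by
  rintro (x | x | x | x) (y | y | y | y) h <;>
    simp [admVec, expVec_inj] at h <;> simp <;> omega

lemma range_admVec (k : ℕ) :
    Set.range (admVec k) = {μ | IsAdm pF123 μ ∧ deg μ = k + 1} := by
  ext μ
  constructor
  · rintro ⟨x | x | x | x, rfl⟩ <;>
      simp only [admVec, Sum.elim_inl, Sum.elim_inr, Set.mem_ofPred_eq, isAdm_expVec,
        deg_expVec] <;> omega
  · rintro ⟨hμ, hk⟩
    rw [eq_expVec μ, isAdm_expVec] at hμ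
    rw [eq_expVec μ, deg_expVec] at hk
    rw [eq_expVec μ]
    generalize μ (Sum.inl 0) = i at *
    generalize μ (Sum.inl 1) = j at *
    generalize μ (Sum.inr 0) = m at *
    generalize μ (Sum.inr 1) = n at *
    obtain ⟨hi, hj⟩ := hμ
    interval_cases i <;> interval_cases j
    · exact ⟨Sum.inl ⟨n, by omega⟩, expVec_inj.2 (by simp; omega)⟩
    · exact ⟨Sum.inr (Sum.inr (Sum.inl ⟨n, by omega⟩)), expVec_inj.2 (by simp; omega)⟩
    · exact ⟨Sum.inr (Sum.inl ⟨n, by omega⟩), expVec_inj.2 (by simp; omega)⟩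
    · exact ⟨Sum.inr (Sum.inr (Sum.inr ⟨n, by omega⟩)), expVec_inj.2 (by simp; omega)⟩

lemma finrank_supported_range {α ι : Type*} [Fintype ι] {e : ι → α}
    (he : Function.Injective e) :
    Module.Finite F (Finsupp.supported F F (Set.range e)) ∧
      Module.finrank F (Finsupp.supported F F (Set.range e)) = Fintype.card ι := by
  let E : Finsupp.supported F F (Set.range e) ≃ₗ[F] (ι →₀ F) :=
    (Finsupp.supportedEquivFinsupp (Set.range e)).trans
      (Finsupp.domLCongr (Equiv.ofInjective e he).symm)
  exact ⟨Module.Finite.equiv E.symm, by rw [E.finrank_eq, Module.finrank_finsupp_self]⟩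

lemma admDeg_succ (k : ℕ) : Module.Finite F (AdmDeg F pF123 (k + 1)) ∧
    Module.finrank F (AdmDeg F pF123 (k + 1)) = 4 * (k + 1) := by
  rw [admDeg_eq_supported, ← range_admVec]
  refine ⟨(finrank_supported_range F (admVec_injective k)).1, ?_⟩
  rw [(finrank_supported_range F (admVec_injective k)).2]
  simp
  ring

lemma admDeg_zero : Module.Finite F (AdmDeg F pF123 0) ∧
    Module.finrank F (AdmDeg F pF123 0) = 1 := by
  have h : {μ : Fin 2 ⊕ Fin 2 → ℕ | IsAdm pF123 μ ∧ deg μ = 0} =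
      Set.range (fun _ : Unit => (0 : Fin 2 ⊕ Fin 2 → ℕ)) := by
    ext μ
    simp only [deg, Finset.sum_eq_zero_iff, Finset.mem_univ, true_imp_iff, Set.mem_ofPred_eq,
      Set.range_const, Set.mem_singleton_iff]
    exact ⟨fun h => funext h.2, by rintro rfl; simp [IsAdm]⟩
  rw [admDeg_eq_supported, h]
  simpa using finrank_supported_range F (Function.injective_of_subsingleton
    (fun _ : Unit => (0 : Fin 2 ⊕ Fin 2 → ℕ)))

/-- A basis of the coboundaries of degree `k + 1`. -/
def bdryFamily (k : ℕ) : Fin k ⊕ Fin k → Cochain F (Fin 2 ⊕ Fin 2) :=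
  Sum.elim (fun n => mono F 1 0 (k - n) n) (fun n => dF123 F (mono F 0 1 (k - 1 - n) n))

lemma linearIndependent_bdryFamily [CharZero F] (k : ℕ) :
    LinearIndependent F (bdryFamily F k) := by
  let v : Fin k ⊕ Fin k → Fin 2 ⊕ Fin 2 → ℕ :=
    Sum.elim (fun n => expVec 1 0 (k - n) n) (fun n => expVec 0 0 (k + 1 - n) n)
  let r : Fin k ⊕ Fin k → Fˣ := Sum.elim 1 (fun _ => -(Units.mk0 2 two_ne_zero)⁻¹)
  let L : Cochain F (Fin 2 ⊕ Fin 2) →ₗ[F] (Fin k ⊕ Fin k → F) :=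
    LinearMap.pi fun x => Finsupp.lapply (v x)
  have h := ((Pi.basisFun F (Fin k ⊕ Fin k)).linearIndependent).units_smul r
  refine LinearIndependent.of_comp L (by
    convert h using 1
    ext x y
    rcases x with x | x <;> rcases y with y | y <;>
      simp only [bdryFamily, Function.comp_apply, Sum.elim_inl, Sum.elim_inr, d_X₁YY] <;>
      simp [L, v, r, mono, Finsupp.single_apply, expVec_inj,
        Pi.single_apply, Fin.ext_iff, Units.smul_def] <;> grind)

lemma map_admDeg_eq_span [CharZero F] (k : ℕ) :
    (AdmDeg F pF123 k).map (dF123 F) = Submodule.span F (Set.range (bdryFamily F k)) := by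
  apply le_antisymm
  · rw [Submodule.map_le_iff_le_comap, admDeg_le_iff]
    intro i j m n hi hj hk
    have hA : ∀ m' n', m' + n' = k → n' < k →
        mono F 1 0 m' n' ∈ Submodule.span F (Set.range (bdryFamily F k)) := by
      intro m' n' h hn
      refine Submodule.subset_span ⟨Sum.inl ⟨n', hn⟩, ?_⟩
      simp [bdryFamily, ← h]
    rw [Submodule.mem_comap]
    interval_cases i <;> interval_cases j
    · rw [d_YY]
      rcases n with _ | n
      · simp
      · exact Submodule.smul_mem _ _ (hA _ _ (by omega) (by omega))
    · refine Submodule.subset_span ⟨Sum.inr ⟨n, by omega⟩, ?_⟩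
      simp only [bdryFamily, Sum.elim_inr]
      congr 2
      omega
    · rw [d_X₀YY]
      exact Submodule.zero_mem _
    · rw [d_X₀X₁YY]
      exact Submodule.smul_mem _ _ (hA _ _ (by omega) (by omega))
  · rw [Submodule.span_le]
    rintro _ ⟨x | x, rfl⟩
    · refine ⟨((x : ℕ) + 1 : F)⁻¹ • mono F 0 0 (k - 1 - x) (x + 1),
        Submodule.smul_mem _ _ (mono_mem_admDeg F (by omega) (by omega) (by omega)), ?_⟩
      have hx : ((x : ℕ) + 1 : F) ≠ 0 := Nat.cast_add_one_ne_zero _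
      have hk : k - 1 - (x : ℕ) + 1 = k - x := by omega
      rw [map_smul, d_YY, hk, smul_smul]
      simp [bdryFamily, hx]
    · exact Submodule.mem_map_of_mem (mono_mem_admDeg F zero_le_one le_rfl (by omega))

lemma finrank_map_admDeg [CharZero F] (k : ℕ) :
    Module.finrank F ((AdmDeg F pF123 k).map (dF123 F)) = 2 * k := by
  rw [map_admDeg_eq_span, finrank_span_eq_card (linearIndependent_bdryFamily F k)]
  simp
  ring

lemma map_admDeg_le_Zk [CharZero F] (k : ℕ) :
    (AdmDeg F pF123 k).map (dF123 F) ≤ Zk F pF123 ordF123 (cF123 F) (k + 1) := by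
  rw [map_admDeg_eq_span, Submodule.span_le]
  rintro _ ⟨x | x, rfl⟩
  · exact ⟨mono_mem_admDeg F le_rfl zero_le_one (by omega), d_X₀YY F _ _⟩
  · simp only [bdryFamily, Sum.elim_inr]
    refine ⟨?_, ?_⟩
    · rw [d_X₁YY]
      refine add_mem (Submodule.smul_mem _ _ (mono_mem_admDeg F (by omega) (by omega) (by omega)))
        ?_
      rcases hx : (x : ℕ) with _ | n
      · simp
      · exact Submodule.smul_mem _ _ (mono_mem_admDeg F (by omega) (by omega) (by omega))
    · change dF123 F (dF123 F _) = 0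
      rw [d_X₁YY, map_add, map_smul, map_smul, d_YY, d_X₀X₁YY, smul_smul, smul_smul, ← add_smul]
      convert zero_smul F _ using 2
      ring

lemma finrank_map_add_finrank_Zk (k : ℕ) [Module.Finite F (AdmDeg F pF123 k)] :
    Module.finrank F ((AdmDeg F pF123 k).map (dF123 F)) +
      Module.finrank F (Zk F pF123 ordF123 (cF123 F) k) =
        Module.finrank F (AdmDeg F pF123 k) := by
  have h := LinearMap.finrank_range_add_finrank_ker (K := F) (V := AdmDeg F pF123 k)
    (V₂ := Cochain F (Fin 2 ⊕ Fin 2)) ((dF123 F).domRestrict (AdmDeg F pF123 k))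
  rw [LinearMap.range_domRestrict, LinearMap.ker_domRestrict] at h
  rw [← h, Zk, ← Submodule.map_comap_subtype, Submodule.finrank_map_subtype_eq]

end

/-- For the filiform Lie superalgebra `F_{1,2}³` (nonzero brackets `[X₀,Y₁] = Y₂`, `[Y₁,Y₁] = X₁`) over an algebraically closed field of characteristic zero, the Betti numbers are `dim H^0 = 1` and `dim H^k = 2` for all `k ≥ 1`. -/
theorem betti_F123
    (F : Type*) [Field F] [IsAlgClosed F] [CharZero F] :
    Hdim F pF123 ordF123 (cF123 F) 0 = 1 ∧
    (∀ k : ℕ, 1 ≤ k → Hdim F pF123 ordF123 (cF123 F) k = 2) := by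
  refine ⟨?_, fun k hk => ?_⟩
  · have := (admDeg_zero F).1
    have hZ := finrank_map_add_finrank_Zk F 0
    have hB := finrank_map_admDeg F 0
    have hle : Module.finrank F ↥(Bk F pF123 ordF123 (cF123 F) 0 ⊓
        Zk F pF123 ordF123 (cF123 F) 0) ≤
        Module.finrank F ((AdmDeg F pF123 0).map (dF123 F)) :=
      Submodule.finrank_mono inf_le_left
    rw [hB, (admDeg_zero F).2] at hZ
    rw [Hdim]
    omega
  · obtain ⟨k, rfl⟩ := Nat.exists_eq_add_of_le' hk
    have := (admDeg_succ F k).1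
    have hZ := finrank_map_add_finrank_Zk F (k + 1)
    rw [finrank_map_admDeg, (admDeg_succ F k).2] at hZ
    rw [Hdim, Bk, Nat.add_sub_cancel, inf_eq_left.2 (map_admDeg_le_Zk F k),
      finrank_map_admDeg]
    omega

end Paper
end
end

section
/- For the filiform Lie superalgebra F_{2,2}^5 over an algebraically closed field of characteristic zero, the Betti numbers of cohomology with trivial coefficients are dim H^0 = 1, dim H^1 = 3, and dim H^k = 4 for all k ≥ 2. -/
open scoped Classical
open Finset

noncomputable section
namespace Paper
open SuperCE

/-- parity of the basis (evens then odds) -/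
def pF225 : Fin 3 ⊕ Fin 2 → ℕ := Sum.elim (fun _ => 0) (fun _ => 1)

/-- ordering of the basis -/
def ordF225 : Fin 3 ⊕ Fin 2 → ℕ :=
  Sum.elim (fun i => (i : ℕ)) (fun j => 3 + (j : ℕ))

/-- structure constants -/
def cF225 (F : Type*) [Field F] :
    (Fin 3 ⊕ Fin 2) → (Fin 3 ⊕ Fin 2) → (Fin 3 ⊕ Fin 2) → F :=
  fun a b t =>
    if a = Sum.inl (0 : Fin 3) ∧ b = Sum.inl (1 : Fin 3) ∧ t = Sum.inl (2 : Fin 3) then 1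
    else if a = Sum.inl (1 : Fin 3) ∧ b = Sum.inl (0 : Fin 3) ∧ t = Sum.inl (2 : Fin 3) then -1
    else    if a = Sum.inr (0 : Fin 2) ∧ b = Sum.inr (0 : Fin 2) ∧ t = Sum.inl (2 : Fin 3) then 1
    else    if a = Sum.inl (0 : Fin 3) ∧ b = Sum.inr (0 : Fin 2) ∧ t = Sum.inr (1 : Fin 2) then 1
    else if a = Sum.inr (0 : Fin 2) ∧ b = Sum.inl (0 : Fin 3) ∧ t = Sum.inr (1 : Fin 2) then -1
    else    if a = Sum.inl (1 : Fin 3) ∧ b = Sum.inr (0 : Fin 2) ∧ t = Sum.inr (1 : Fin 2) then 1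
    else if a = Sum.inr (0 : Fin 2) ∧ b = Sum.inl (1 : Fin 3) ∧ t = Sum.inr (1 : Fin 2) then -1
    else 0

end Paper
end

noncomputable section
namespace Paper
open SuperCE

/-- The exponent vector of `X₀*ᵃ X₁*ᵇ X₂*ᶜ Y₁*ⁱ Y₂*ʲ`. -/
def mon (a b c i j : ℕ) : Fin 3 ⊕ Fin 2 → ℕ := Sum.elim ![a, b, c] ![i, j]

lemma mon_eta (μ : Fin 3 ⊕ Fin 2 → ℕ) :
    mon (μ (Sum.inl 0)) (μ (Sum.inl 1)) (μ (Sum.inl 2)) (μ (Sum.inr 0)) (μ (Sum.inr 1)) = μ := by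
  funext x
  rcases x with x | x <;> fin_cases x <;> rfl

lemma mon_inj {a b c i j a' b' c' i' j' : ℕ} :
    mon a b c i j = mon a' b' c' i' j' ↔ a = a' ∧ b = b' ∧ c = c' ∧ i = i' ∧ j = j' := by
  simp [mon, Sum.elim_eq_iff, and_assoc]

lemma isAdm_mon {a b c i j : ℕ} : IsAdm pF225 (mon a b c i j) ↔ a ≤ 1 ∧ b ≤ 1 ∧ c ≤ 1 := by
  simp [IsAdm, pF225, mon, Fin.forall_fin_succ]

lemma deg_mon (a b c i j : ℕ) : deg (mon a b c i j) = a + b + c + i + j := by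
  simp [deg, mon, Fin.sum_univ_succ]
  ring

section Differential

variable (F : Type*) [Field F]

lemma sgnProd_mon (a b c i j a' b' c' i' j' : ℕ) :
    sgnProd F pF225 ordF225 (mon a b c i j) (mon a' b' c' i' j') =
      (-1) ^ (b * a' + c * (a' + b') + (i + j) * (a' + b' + c') + 2 * (j * i')) := by
  simp [sgnProd, mon, pF225, ordF225, Fin.sum_univ_succ]
  ring_nf

lemma mon_sub_eps_two (a b c i j : ℕ) :
    (fun t => mon a b c i j t - eps (Sum.inl 2) t) = mon a b (c - 1) i j := by
  funext x
  rcases x with x | x <;> fin_cases x <;> simp [mon, eps]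

lemma mon_sub_eps_four (a b c i j : ℕ) :
    (fun t => mon a b c i j t - eps (Sum.inr 1) t) = mon a b c i (j - 1) := by
  funext x
  rcases x with x | x <;> fin_cases x <;> simp [mon, eps]

lemma eps_add_eps :
    (fun t : Fin 3 ⊕ Fin 2 => eps (Sum.inl 0) t + eps (Sum.inl 1) t) = mon 1 1 0 0 0 ∧
    (fun t : Fin 3 ⊕ Fin 2 => eps (Sum.inr 0) t + eps (Sum.inr 0) t) = mon 0 0 0 2 0 ∧
    (fun t : Fin 3 ⊕ Fin 2 => eps (Sum.inl 0) t + eps (Sum.inr 0) t) = mon 1 0 0 1 0 ∧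
    (fun t : Fin 3 ⊕ Fin 2 => eps (Sum.inl 1) t + eps (Sum.inr 0) t) = mon 0 1 0 1 0 := by
  refine ⟨?_, ?_, ?_, ?_⟩ <;> funext x <;> rcases x with x | x <;> fin_cases x <;> simp [mon, eps]

lemma tgt_mon (a b c i j : ℕ) :
    tgt (mon a b c i j) (Sum.inl 2) (Sum.inl 0) (Sum.inl 1) = mon (a + 1) (b + 1) (c - 1) i j ∧
    tgt (mon a b c i j) (Sum.inl 2) (Sum.inr 0) (Sum.inr 0) = mon a b (c - 1) (i + 2) j ∧
    tgt (mon a b c i j) (Sum.inr 1) (Sum.inl 0) (Sum.inr 0) = mon (a + 1) b c (i + 1) (j - 1) ∧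
    tgt (mon a b c i j) (Sum.inr 1) (Sum.inl 1) (Sum.inr 0) = mon a (b + 1) c (i + 1) (j - 1) := by
  refine ⟨?_, ?_, ?_, ?_⟩ <;> funext x <;> rcases x with x | x <;> fin_cases x <;>
    simp [tgt, mon, eps]

lemma pF225_inl (x : Fin 3) : pF225 (Sum.inl x) = 0 := rfl

lemma pF225_inr (x : Fin 2) : pF225 (Sum.inr x) = 1 := rfl

lemma ordF225_inl (x : Fin 3) : ordF225 (Sum.inl x) = x := rfl

lemma ordF225_inr (x : Fin 2) : ordF225 (Sum.inr x) = 3 + x := rfl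

lemma mon_apply (a b c i j : ℕ) :
    mon a b c i j (Sum.inl 0) = a ∧ mon a b c i j (Sum.inl 1) = b ∧
    mon a b c i j (Sum.inl 2) = c ∧ mon a b c i j (Sum.inr 0) = i ∧
    mon a b c i j (Sum.inr 1) = j := ⟨rfl, rfl, rfl, rfl, rfl⟩

lemma dMono_mon (a b c i j : ℕ) :
    dMono F pF225 ordF225 (cF225 F) (mon a b c i j) =
      (if c ≠ 0 ∧ a = 0 ∧ b = 0 ∧ c ≤ 2 then
        Finsupp.single (mon (a + 1) (b + 1) (c - 1) i j) ((-1 : F) ^ (a + b) * c * (-1) ^ b) else 0) +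
      (if c ≠ 0 ∧ a ≤ 1 ∧ b ≤ 1 ∧ c ≤ 2 then
        Finsupp.single (mon a b (c - 1) (i + 2) j) ((-1 : F) ^ (a + b) * c * -2⁻¹) else 0) +
      (if j ≠ 0 ∧ a = 0 ∧ b ≤ 1 ∧ c ≤ 1 then
        Finsupp.single (mon (a + 1) b c (i + 1) (j - 1)) ((-1 : F) ^ a * j) else 0) +
      (if j ≠ 0 ∧ a ≤ 1 ∧ b = 0 ∧ c ≤ 1 then
        Finsupp.single (mon a (b + 1) c (i + 1) (j - 1)) ((-1 : F) ^ (a + b) * j) else 0) := by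
  obtain ⟨e1, e2, e3, e4⟩ := eps_add_eps
  obtain ⟨t1, t2, t3, t4⟩ := tgt_mon a b c i j
  obtain ⟨m1, m2, m3, m4, m5⟩ := mon_apply a b c i j
  simp only [dMono, Fintype.sum_sum_type, Fin.sum_univ_succ, Fin.sum_univ_zero]
  simp [dcoef, cF225, pF225_inl, pF225_inr, ordF225_inl, ordF225_inr, -ne_eq, -Finsupp.single_mul,
    -Finsupp.single_neg, e1, e2, e3, e4, t1, t2, t3, t4, m1, m2, m3, m4, m5, isAdm_mon,
    mon_sub_eps_two, mon_sub_eps_four, sgnProd_mon]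
  have s1 : (-1 : F) ^ (b + (c - 1) * 2 + (i + j) * 2) = (-1) ^ b := by
    simp [pow_add, pow_mul']
  have s3 : (-1 : F) ^ (a + (b + c) + i) * j * (-1) ^ (j - 1) *
      (-1) ^ (b + c + (i + (j - 1)) + 2 * (j - 1)) = (-1) ^ a * j := by
    simp only [pow_add, pow_mul]
    rcases neg_one_pow_eq_or F b with h | h <;> rcases neg_one_pow_eq_or F c with hc | hc <;>
      rcases neg_one_pow_eq_or F i with hi | hi <;>
      rcases neg_one_pow_eq_or F (j - 1) with hj | hj <;> simp [*]
  have s4 : (-1 : F) ^ (a + (b + c) + i) * j * (-1) ^ (j - 1) *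
      (-1) ^ (c + (i + (j - 1)) + 2 * (j - 1)) = (-1) ^ (a + b) * j := by
    simp only [pow_add, pow_mul]
    rcases neg_one_pow_eq_or F c with hc | hc <;>
      rcases neg_one_pow_eq_or F i with hi | hi <;>
      rcases neg_one_pow_eq_or F (j - 1) with hj | hj <;> simp [*]
  rw [s1, s3, s4, ← add_assoc]

/-- The monomial `X₀*ᵃ X₁*ᵇ X₂*ᶜ Y₁*ⁱ Y₂*ʲ` as a cochain. -/
def term (a b c i j : ℕ) : Cochain F (Fin 3 ⊕ Fin 2) := Finsupp.single (mon a b c i j) 1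

lemma single_mon (a b c i j : ℕ) (r : F) :
    Finsupp.single (mon a b c i j) r = r • term F a b c i j := by
  simp [term]

lemma d_term (a b c i j : ℕ) :
    d F pF225 ordF225 (cF225 F) (term F a b c i j) =
      dMono F pF225 ordF225 (cF225 F) (mon a b c i j) := by
  simp [d, term]

lemma d_term_000 (i j : ℕ) : d F pF225 ordF225 (cF225 F) (term F 0 0 0 i j) =
    (j : F) • (term F 1 0 0 (i + 1) (j - 1) + term F 0 1 0 (i + 1) (j - 1)) := by
  rcases j with _ | j <;> simp [d_term, dMono_mon, single_mon, -Finsupp.single_add]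

lemma d_term_100 (i j : ℕ) : d F pF225 ordF225 (cF225 F) (term F 1 0 0 i j) =
    -(j : F) • term F 1 1 0 (i + 1) (j - 1) := by
  rcases j with _ | j <;> simp [d_term, dMono_mon, single_mon, -Finsupp.single_add]

lemma d_term_010 (i j : ℕ) : d F pF225 ordF225 (cF225 F) (term F 0 1 0 i j) =
    (j : F) • term F 1 1 0 (i + 1) (j - 1) := by
  rcases j with _ | j <;> simp [d_term, dMono_mon, single_mon, -Finsupp.single_add]

lemma d_term_110 (i j : ℕ) : d F pF225 ordF225 (cF225 F) (term F 1 1 0 i j) = 0 := by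
  simp [d_term, dMono_mon]

lemma d_term_001 (i j : ℕ) : d F pF225 ordF225 (cF225 F) (term F 0 0 1 i j) =
    term F 1 1 0 i j - (2 : F)⁻¹ • term F 0 0 0 (i + 2) j +
      (j : F) • (term F 1 0 1 (i + 1) (j - 1) + term F 0 1 1 (i + 1) (j - 1)) := by
  rcases j with _ | j <;> simp [d_term, dMono_mon, single_mon, -Finsupp.single_add] <;> module

lemma d_term_101 (i j : ℕ) : d F pF225 ordF225 (cF225 F) (term F 1 0 1 i j) =
    (2 : F)⁻¹ • term F 1 0 0 (i + 2) j - (j : F) • term F 1 1 1 (i + 1) (j - 1) := by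
  rcases j with _ | j <;> simp [d_term, dMono_mon, single_mon, -Finsupp.single_add]
  module

lemma d_term_011 (i j : ℕ) : d F pF225 ordF225 (cF225 F) (term F 0 1 1 i j) =
    (2 : F)⁻¹ • term F 0 1 0 (i + 2) j + (j : F) • term F 1 1 1 (i + 1) (j - 1) := by
  rcases j with _ | j <;> simp [d_term, dMono_mon, single_mon, -Finsupp.single_add]

lemma d_term_111 (i j : ℕ) : d F pF225 ordF225 (cF225 F) (term F 1 1 1 i j) =
    -(2 : F)⁻¹ • term F 1 1 0 (i + 2) j := by
  simp [d_term, dMono_mon, single_mon]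

/-- Values on the monomials `X₀* X₁* Y₁*ⁱ Y₂*ʲ` of the homotopy below. -/
def homotopyTop : ℕ → ℕ → Cochain F (Fin 3 ⊕ Fin 2)
  | 0, _ => 0
  | 1, j => -((j : F) + 1)⁻¹ • term F 1 0 0 0 (j + 1)
  | i + 2, j => (-2 : F) • term F 1 1 1 i j

/-- Values on monomials of a degree `-1` map `h` with `d h d = d`. -/
def homotopyMono : ℕ → ℕ → ℕ → ℕ → ℕ → Cochain F (Fin 3 ⊕ Fin 2)
  | 0, 0, 0, i + 2, j => (-2 : F) • term F 0 0 1 i j + (2 : F) • homotopyTop F i j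
  | 1, 0, 0, i + 2, j => (2 : F) • term F 1 0 1 i j
  | 0, 1, 0, i + 2, j => (2 : F) • term F 0 1 1 i j
  | 0, 1, 0, 1, j => ((j : F) + 1)⁻¹ • term F 0 0 0 0 (j + 1)
  | 1, 1, 0, i, j => homotopyTop F i j
  | _, _, _, _, _ => 0

/-- A degree `-1` map `h` with `d h d = d`. -/
def homotopy : Cochain F (Fin 3 ⊕ Fin 2) →ₗ[F] Cochain F (Fin 3 ⊕ Fin 2) :=
  Finsupp.lsum F fun μ => LinearMap.toSpanSingleton F _
    (homotopyMono F (μ (Sum.inl 0)) (μ (Sum.inl 1)) (μ (Sum.inl 2)) (μ (Sum.inr 0)) (μ (Sum.inr 1)))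

lemma homotopy_term (a b c i j : ℕ) :
    homotopy F (term F a b c i j) = homotopyMono F a b c i j := by
  obtain ⟨m1, m2, m3, m4, m5⟩ := mon_apply a b c i j
  simp [homotopy, term, m1, m2, m3, m4, m5]

/-- Exponents of the admissible monomials of degree `k`. -/
def admExp (k : ℕ) : Finset (Σ _ : Fin 2 × Fin 2 × Fin 2, ℕ × ℕ) :=
  univ.sigma fun e =>
    if e.1.val + e.2.1.val + e.2.2.val ≤ k then
      antidiagonal (k - (e.1.val + e.2.1.val + e.2.2.val)) else ∅

/-- Exponents of monomials of degree `k` spanning a complement of the cocycles. -/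
def pivotExp (k : ℕ) : Finset (Σ _ : Fin 2 × Fin 2 × Fin 2, ℕ × ℕ) :=
  univ.sigma fun e =>
    if e.2.2 = 1 then
      if e.1.val + e.2.1.val + 1 ≤ k then antidiagonal (k - (e.1.val + e.2.1.val + 1)) else ∅
    else if e.2.1 = 0 ∧ e.1.val + 1 ≤ k then {(0, k - e.1.val)} else ∅

/-- The monomial with the given exponents. -/
def monEmb : (Σ _ : Fin 2 × Fin 2 × Fin 2, ℕ × ℕ) ↪ (Fin 3 ⊕ Fin 2 → ℕ) where
  toFun x := mon x.1.1 x.1.2.1 x.1.2.2 x.2.1 x.2.2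
  inj' := by
    rintro ⟨⟨a, b, c⟩, i, j⟩ ⟨⟨a', b', c'⟩, i', j'⟩ h
    obtain ⟨h1, h2, h3, rfl, rfl⟩ := mon_inj.1 h
    obtain rfl := Fin.ext h1
    obtain rfl := Fin.ext h2
    obtain rfl := Fin.ext h3
    rfl

lemma mon_mem_admExp {a b c i j k : ℕ} :
    mon a b c i j ∈ (admExp k).map monEmb ↔
      (a ≤ 1 ∧ b ≤ 1 ∧ c ≤ 1) ∧ a + b + c + i + j = k := by
  constructor
  · intro h
    obtain ⟨⟨⟨a', b', c'⟩, i', j'⟩, hx, he⟩ := mem_map.1 h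
    obtain ⟨rfl, rfl, rfl, rfl, rfl⟩ := mon_inj.1 he
    simp only [admExp, mem_sigma, mem_univ, true_and] at hx
    split_ifs at hx with h1
    · rw [HasAntidiagonal.mem_antidiagonal] at hx
      simp only at hx h1 ⊢
      omega
    · simp at hx
  · rintro ⟨⟨ha, hb, hc⟩, hk⟩
    refine mem_map.2 ⟨⟨⟨⟨a, by omega⟩, ⟨b, by omega⟩, ⟨c, by omega⟩⟩, i, j⟩, ?_, rfl⟩
    simp only [admExp, mem_sigma, mem_univ, true_and]
    rw [if_pos (by omega), HasAntidiagonal.mem_antidiagonal]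
    simp only
    omega

lemma mon_mem_pivotExp {a b c i j k : ℕ} :
    mon a b c i j ∈ (pivotExp k).map monEmb ↔
      (a ≤ 1 ∧ b ≤ 1 ∧ c ≤ 1) ∧ a + b + c + i + j = k ∧
        (c = 1 ∨ c = 0 ∧ b = 0 ∧ i = 0 ∧ 1 ≤ j) := by
  constructor
  · intro h
    obtain ⟨⟨⟨a', b', c'⟩, i', j'⟩, hx, he⟩ := mem_map.1 h
    obtain ⟨rfl, rfl, rfl, rfl, rfl⟩ := mon_inj.1 he
    simp only [pivotExp, mem_sigma, mem_univ, true_and, Fin.ext_iff] at hx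
    split_ifs at hx with h1 h2 h3
    · rw [HasAntidiagonal.mem_antidiagonal] at hx
      simp at hx h1 h2 ⊢
      omega
    · simp at hx
    · simp at hx h1 h3 ⊢
      omega
    · simp at hx
  · rintro ⟨⟨ha, hb, hc⟩, hk, hp⟩
    refine mem_map.2 ⟨⟨⟨⟨a, by omega⟩, ⟨b, by omega⟩, ⟨c, by omega⟩⟩, i, j⟩, ?_, rfl⟩
    simp only [pivotExp, mem_sigma, mem_univ, true_and, Fin.ext_iff]
    rcases hp with rfl | ⟨rfl, rfl, rfl, hj⟩
    · rw [if_pos (by simp), if_pos (by omega), HasAntidiagonal.mem_antidiagonal]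
      simp only
      omega
    · rw [if_neg (by simp), if_pos ⟨by simp, by omega⟩, mem_singleton]
      simp only [Prod.mk.injEq, true_and]
      omega

lemma card_admExp_zero : (admExp 0).card = 1 := by
  simp [admExp, Fintype.sum_prod_type, Fin.sum_univ_succ]

lemma card_admExp_one : (admExp 1).card = 5 := by
  simp [admExp, Fintype.sum_prod_type, Fin.sum_univ_succ]

lemma card_admExp (k : ℕ) : (admExp (k + 2)).card = 8 * k + 12 := by
  rcases k with _ | k
  · simp [admExp, Fintype.sum_prod_type, Fin.sum_univ_succ]
  · simp [admExp, Fintype.sum_prod_type, Fin.sum_univ_succ]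
    omega

lemma card_pivotExp_zero : (pivotExp 0).card = 0 := by
  simp [pivotExp]

lemma card_pivotExp (k : ℕ) : (pivotExp (k + 1)).card = 4 * k + 2 := by
  rcases k with _ | _ | k
  · simp [pivotExp, Fintype.sum_prod_type, Fin.sum_univ_succ]
  · simp [pivotExp, Fintype.sum_prod_type, Fin.sum_univ_succ]
  · simp [pivotExp, Fintype.sum_prod_type, Fin.sum_univ_succ]
    omega

lemma finrank_supported {ι : Type*} (s : Finset ι) :
    Module.finrank F (Finsupp.supported F F (s : Set ι)) = s.card := by
  rw [(Finsupp.supportedEquivFinsupp (M := F) (R := F) (s : Set ι)).finrank_eq,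
    Module.finrank_finsupp_self]
  simp

lemma admDeg_eq (k : ℕ) :
    AdmDeg F pF225 k = Finsupp.supported F F ((admExp k).map monEmb : Set (Fin 3 ⊕ Fin 2 → ℕ)) := by
  ext f
  rw [Finsupp.mem_supported]
  refine forall_congr' fun μ => ?_
  rw [Finset.mem_coe, Finsupp.mem_support_iff, ← mon_eta μ, Finset.mem_coe, mon_mem_admExp,
    isAdm_mon, deg_mon]

lemma supported_le {ι : Type*} {s : Set ι} {P : Submodule F (ι →₀ F)}
    (h : ∀ x ∈ s, Finsupp.single x 1 ∈ P) : Finsupp.supported F F s ≤ P := by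
  rw [Finsupp.supported_eq_span_single, Submodule.span_le]
  rintro _ ⟨x, hx, rfl⟩
  exact h x hx

lemma d_d_term {a b c : ℕ} (ha : a ≤ 1) (hb : b ≤ 1) (hc : c ≤ 1) (i j : ℕ) :
    d F pF225 ordF225 (cF225 F) (d F pF225 ordF225 (cF225 F) (term F a b c i j)) = 0 := by
  interval_cases a <;> interval_cases b <;> interval_cases c <;>
    simp only [d_term_000, d_term_001, d_term_010, d_term_011, d_term_100, d_term_101, d_term_110,
      d_term_111, map_add, map_sub, map_smul, map_zero, add_assoc, Nat.reduceAdd] <;> module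

lemma homotopy_d_term [CharZero F] {a b c : ℕ} (ha : a ≤ 1) (hb : b ≤ 1) (i j : ℕ)
    (hp : c = 1 ∨ c = 0 ∧ b = 0 ∧ i = 0 ∧ 1 ≤ j) :
    homotopy F (d F pF225 ordF225 (cF225 F) (term F a b c i j)) = term F a b c i j := by
  rcases hp with rfl | ⟨rfl, rfl, rfl, hj⟩
  · interval_cases a <;> interval_cases b <;>
      simp only [d_term_001, d_term_011, d_term_101, d_term_111, map_add, map_sub, map_smul,
        homotopy_term, homotopyMono, homotopyTop] <;> module
  · obtain ⟨j, rfl⟩ := Nat.exists_eq_add_of_le' hj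
    have : (j : F) + 1 ≠ 0 := by exact_mod_cast j.succ_ne_zero
    interval_cases a <;>
      simp [d_term_000, d_term_100, homotopy_term, homotopyMono, homotopyTop, smul_smul, this,
        -neg_add_rev]

lemma d_homotopy_d_term [CharZero F] {a b c : ℕ} (ha : a ≤ 1) (hb : b ≤ 1) (hc : c ≤ 1) (i j : ℕ) :
    d F pF225 ordF225 (cF225 F) (homotopy F (d F pF225 ordF225 (cF225 F) (term F a b c i j))) =
      d F pF225 ordF225 (cF225 F) (term F a b c i j) := by
  by_cases hp : c = 1 ∨ c = 0 ∧ b = 0 ∧ i = 0 ∧ 1 ≤ j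
  · rw [homotopy_d_term F ha hb i j hp]
  obtain rfl : c = 0 := by omega
  have (j : ℕ) : (j : F) + 1 ≠ 0 := by exact_mod_cast j.succ_ne_zero
  rcases j with _ | j
  · interval_cases a <;> interval_cases b <;>
      simp [d_term_000, d_term_010, d_term_100, d_term_110]
  rcases i with _ | i
  · obtain rfl : b = 1 := by omega
    interval_cases a
    · simp [d_term_010, d_term_100, homotopy_term, homotopyMono, homotopyTop, smul_smul, this,
        -neg_add_rev]
    · simp [d_term_110]
  · interval_cases a <;> interval_cases b <;>
      simp only [d_term_000, d_term_010, d_term_011, d_term_100, d_term_101,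
        d_term_110, d_term_111, map_add, map_smul, map_zero, homotopy_term, homotopyMono,
        homotopyTop, add_tsub_cancel_right, add_assoc, Nat.reduceAdd] <;> module

lemma term_mem_pivot {a b c i j k : ℕ} (ha : a ≤ 1) (hb : b ≤ 1) (hc : c ≤ 1)
    (hk : a + b + c + i + j = k) (hp : c = 1 ∨ c = 0 ∧ b = 0 ∧ i = 0 ∧ 1 ≤ j) :
    term F a b c i j ∈
      Finsupp.supported F F ((pivotExp k).map monEmb : Set (Fin 3 ⊕ Fin 2 → ℕ)) :=
  Finsupp.single_mem_supported F 1 (mon_mem_pivotExp.2 ⟨⟨ha, hb, hc⟩, hk, hp⟩)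

lemma term_mem_admDeg {a b c i j k : ℕ} (ha : a ≤ 1) (hb : b ≤ 1) (hc : c ≤ 1)
    (hk : a + b + c + i + j = k) : term F a b c i j ∈ AdmDeg F pF225 k := by
  rw [admDeg_eq]
  exact Finsupp.single_mem_supported F 1 (mon_mem_admExp.2 ⟨⟨ha, hb, hc⟩, hk⟩)

lemma admDeg_le {k : ℕ} {P : Submodule F (Cochain F (Fin 3 ⊕ Fin 2))}
    (h : ∀ a b c i j, a ≤ 1 → b ≤ 1 → c ≤ 1 → a + b + c + i + j = k → term F a b c i j ∈ P) :
    AdmDeg F pF225 k ≤ P := by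
  rw [admDeg_eq]
  refine supported_le F fun μ hμ => ?_
  rw [Finset.mem_coe, ← mon_eta μ, mon_mem_admExp] at hμ
  rw [← mon_eta μ]
  exact h _ _ _ _ _ hμ.1.1 hμ.1.2.1 hμ.1.2.2 hμ.2

lemma homotopyTop_mem {i j k : ℕ} (h : i + j + 1 = k) : homotopyTop F i j ∈
    Finsupp.supported F F ((pivotExp k).map monEmb : Set (Fin 3 ⊕ Fin 2 → ℕ)) := by
  rcases i with _ | _ | i
  · exact Submodule.zero_mem _
  all_goals
    refine Submodule.smul_mem _ _ (term_mem_pivot F ?_ ?_ ?_ ?_ ?_) <;> omega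

lemma homotopy_mem (k : ℕ) : AdmDeg F pF225 (k + 1) ≤
    (Finsupp.supported F F ((pivotExp k).map monEmb : Set (Fin 3 ⊕ Fin 2 → ℕ))).comap
      (homotopy F) := by
  refine admDeg_le F fun a b c i j ha hb hc hk => ?_
  rw [Submodule.mem_comap, homotopy_term]
  interval_cases c <;> interval_cases a <;> interval_cases b <;> rcases i with _ | _ | i <;>
    simp only [homotopyMono, Submodule.zero_mem]
  · refine Submodule.add_mem _ (Submodule.smul_mem _ _ (term_mem_pivot F ?_ ?_ ?_ ?_ ?_))
      (Submodule.smul_mem _ _ (homotopyTop_mem F ?_)) <;> omega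
  all_goals first
    | refine homotopyTop_mem F ?_; omega
    | refine Submodule.smul_mem _ _ (term_mem_pivot F ?_ ?_ ?_ ?_ ?_) <;> omega

lemma d_homotopy_d [CharZero F] {k : ℕ} {x : Cochain F (Fin 3 ⊕ Fin 2)}
    (hx : x ∈ AdmDeg F pF225 k) :
    d F pF225 ordF225 (cF225 F) (homotopy F (d F pF225 ordF225 (cF225 F) x)) =
      d F pF225 ordF225 (cF225 F) x := by
  set D := d F pF225 ordF225 (cF225 F)
  have : AdmDeg F pF225 k ≤ LinearMap.eqLocus (D ∘ₗ homotopy F ∘ₗ D) D :=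
    admDeg_le F fun a b c i j ha hb hc _ => d_homotopy_d_term F ha hb hc i j
  exact this hx

lemma d_d (k : ℕ) : AdmDeg F pF225 k ≤
    LinearMap.ker (d F pF225 ordF225 (cF225 F) ∘ₗ d F pF225 ordF225 (cF225 F)) :=
  admDeg_le F fun _ _ _ i j ha hb hc _ => d_d_term F ha hb hc i j

lemma d_mem (k : ℕ) :
    AdmDeg F pF225 k ≤ (AdmDeg F pF225 (k + 1)).comap (d F pF225 ordF225 (cF225 F)) := by
  refine admDeg_le F fun a b c i j ha hb hc hk => ?_
  rw [Submodule.mem_comap]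
  interval_cases c <;> interval_cases a <;> interval_cases b <;> rcases j with _ | j <;>
    simp only [d_term_000, d_term_001, d_term_010, d_term_011, d_term_100, d_term_101, d_term_110,
      d_term_111, Submodule.zero_mem, Nat.cast_zero, zero_smul, neg_zero, add_zero, sub_zero,
      add_tsub_cancel_right]
  all_goals
    repeat' first
      | apply Submodule.add_mem
      | apply Submodule.sub_mem
      | apply Submodule.smul_mem
      | apply term_mem_admDeg
    all_goals omega

lemma map_d_admDeg [CharZero F] (k : ℕ) :
    (AdmDeg F pF225 k).map (d F pF225 ordF225 (cF225 F)) =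
      (Finsupp.supported F F ((pivotExp k).map monEmb : Set (Fin 3 ⊕ Fin 2 → ℕ))).map
        (d F pF225 ordF225 (cF225 F)) := by
  refine le_antisymm ?_ (Submodule.map_mono ?_)
  · rintro _ ⟨x, hx, rfl⟩
    exact ⟨_, homotopy_mem F k (d_mem F k hx), d_homotopy_d F hx⟩
  · refine supported_le F fun μ hμ => ?_
    rw [Finset.mem_coe, ← mon_eta μ, mon_mem_pivotExp] at hμ
    rw [← mon_eta μ]
    exact term_mem_admDeg F hμ.1.1 hμ.1.2.1 hμ.1.2.2 hμ.2.1

lemma homotopy_d [CharZero F] {k : ℕ} {x : Cochain F (Fin 3 ⊕ Fin 2)}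
    (hx : x ∈ Finsupp.supported F F ((pivotExp k).map monEmb : Set (Fin 3 ⊕ Fin 2 → ℕ))) :
    homotopy F (d F pF225 ordF225 (cF225 F) x) = x := by
  have : Finsupp.supported F F ((pivotExp k).map monEmb : Set (Fin 3 ⊕ Fin 2 → ℕ)) ≤
      LinearMap.eqLocus (homotopy F ∘ₗ d F pF225 ordF225 (cF225 F)) LinearMap.id := by
    refine supported_le F fun μ hμ => ?_
    rw [Finset.mem_coe, ← mon_eta μ, mon_mem_pivotExp] at hμ
    rw [← mon_eta μ]
    exact homotopy_d_term F hμ.1.1 hμ.1.2.1 _ _ hμ.2.2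
  exact this hx

lemma finrank_map_d [CharZero F] (k : ℕ) :
    Module.finrank F ((AdmDeg F pF225 k).map (d F pF225 ordF225 (cF225 F))) =
      (pivotExp k).card := by
  rw [map_d_admDeg, ← LinearMap.range_domRestrict, LinearMap.finrank_range_of_inj,
    finrank_supported, card_map]
  rintro ⟨x, hx⟩ ⟨y, hy⟩ h
  simp only [LinearMap.domRestrict_apply] at h
  exact Subtype.ext ((homotopy_d F hx).symm.trans (h ▸ homotopy_d F hy))

lemma finrank_Zk_add [CharZero F] (k : ℕ) :
    Module.finrank F (Zk F pF225 ordF225 (cF225 F) k) + (pivotExp k).card =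
      (admExp k).card := by
  have : Module.Finite F (AdmDeg F pF225 k) := by
    rw [admDeg_eq]
    exact Module.Finite.equiv (Finsupp.supportedEquivFinsupp _).symm
  have h := LinearMap.finrank_range_add_finrank_ker (K := F) (V := AdmDeg F pF225 k)
    (V₂ := Cochain F (Fin 3 ⊕ Fin 2))
    ((d F pF225 ordF225 (cF225 F)).domRestrict (AdmDeg F pF225 k))
  rw [LinearMap.range_domRestrict, finrank_map_d, LinearMap.ker_domRestrict,
    ← Submodule.finrank_map_subtype_eq, Submodule.map_comap_subtype] at h
  rw [Zk, add_comm, h, admDeg_eq, finrank_supported, card_map]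

lemma Hdim_zero [CharZero F] : Hdim F pF225 ordF225 (cF225 F) 0 = 1 := by
  have hB : Bk F pF225 ordF225 (cF225 F) 0 = ⊥ := by
    rw [Bk, Nat.zero_sub, map_d_admDeg, card_eq_zero.1 card_pivotExp_zero]
    simp
  have h := finrank_Zk_add F 0
  rw [card_pivotExp_zero, card_admExp_zero] at h
  rw [Hdim, hB, bot_inf_eq, finrank_bot]
  omega

lemma Hdim_succ [CharZero F] (k : ℕ) : Hdim F pF225 ordF225 (cF225 F) (k + 1) =
    (admExp (k + 1)).card - (pivotExp (k + 1)).card - (pivotExp k).card := by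
  have hB : Bk F pF225 ordF225 (cF225 F) (k + 1) ≤ Zk F pF225 ordF225 (cF225 F) (k + 1) := by
    rintro _ ⟨x, hx, rfl⟩
    exact ⟨d_mem F k hx, d_d F k hx⟩
  rw [Hdim, inf_eq_left.2 hB, Bk, Nat.add_sub_cancel, finrank_map_d, ← finrank_Zk_add F (k + 1),
    Nat.add_sub_cancel]

end Differential

/-- For the filiform Lie superalgebra `F_{2,2}⁵` (nonzero brackets `[X₀,X₁] = [Y₁,Y₁] = X₂`, `[X₀,Y₁] = [X₁,Y₁] = Y₂`) over an algebraically closed field of characteristic zero, the Betti numbers are `dim H^0 = 1`, `dim H^1 = 3` and `dim H^k = 4` for all `k ≥ 2`. -/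
theorem betti_F225
    (F : Type*) [Field F] [IsAlgClosed F] [CharZero F] :
    Hdim F pF225 ordF225 (cF225 F) 0 = 1 ∧
    Hdim F pF225 ordF225 (cF225 F) 1 = 3 ∧
    (∀ k : ℕ, 2 ≤ k → Hdim F pF225 ordF225 (cF225 F) k = 4) := by
  refine ⟨Hdim_zero F, ?_, fun k hk => ?_⟩
  · rw [Hdim_succ, card_admExp_one, card_pivotExp, card_pivotExp_zero]
  · obtain ⟨k, rfl⟩ := Nat.exists_eq_add_of_le' hk
    rw [Hdim_succ, card_admExp, card_pivotExp, card_pivotExp]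
    omega

end Paper
end
end
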